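/- arXiv:2009.05315 — 5 statements merged into one kernel-verified Lean document; each statement's English description precedes it below -/
import Mathlib

section
/- Let 𝔏 be an infinite set and S a nonempty finite set. Let 𝒰 be a nontrivial separable unital complex C*-algebra equipped with a family a : 𝔏 × S → 𝒰 satisfying the canonical anticommutation relations and generating 𝒰 topologically, and let σ be the parity automorphism. Then the set of extreme points of the convex weak*-compact set E⁺ of even states is weak*-dense in E⁺; that is, E⁺ equals the weak*-closure of its set of extreme points. -/
open ComplexOrder
open scoped Classical

/-- A family `a : 𝔏 × S → 𝒰` satisfying the canonical anticommutation relations. -/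
def IsCARFamily {𝔏 S 𝒰 : Type*} [CStarAlgebra 𝒰] (a : 𝔏 × S → 𝒰) : Prop :=
  (∀ (x y : 𝔏) (s t : S), a (x, s) * a (y, t) + a (y, t) * a (x, s) = 0) ∧
  (∀ (x y : 𝔏) (s t : S), a (x, s) * star (a (y, t)) + star (a (y, t)) * a (x, s) =
      if x = y ∧ s = t then (1 : 𝒰) else 0)

/-- The state space of a unital C*-algebra, as a subset of the weak-* dual. -/
def stateSpace (𝒰 : Type*) [CStarAlgebra 𝒰] : Set (WeakDual ℂ 𝒰) :=
  {ρ | ρ 1 = 1 ∧ ∀ b : 𝒰, 0 ≤ ρ (star b * b)}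

section States

variable {𝒰 : Type*} [CStarAlgebra 𝒰]

/-- Positive functionals are hermitian. -/
theorem pos_herm (ρ : WeakDual ℂ 𝒰) (h : ∀ b : 𝒰, 0 ≤ ρ (star b * b)) (b c : 𝒰) :
    starRingEnd ℂ (ρ (star c * b)) = ρ (star b * c) := by
  have h1 := (Complex.nonneg_iff.1 (h (b + c))).2
  have h2 := (Complex.nonneg_iff.1 (h (b + Complex.I • c))).2
  have h3 := (Complex.nonneg_iff.1 (h b)).2
  have h4 := (Complex.nonneg_iff.1 (h c)).2
  have e1 : ρ (star (b + c) * (b + c)) = ρ (star b * b) + ρ (star b * c) + ρ (star c * b)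
      + ρ (star c * c) := by
    simp only [star_add, add_mul, mul_add, map_add]; ring
  have e2 : ρ (star (b + Complex.I • c) * (b + Complex.I • c)) = ρ (star b * b)
      + Complex.I * ρ (star b * c) - Complex.I * ρ (star c * b) + ρ (star c * c) := by
    simp only [star_add, add_mul, mul_add, map_add, star_smul, smul_mul_assoc, mul_smul_comm,
      map_smul, smul_eq_mul, RCLike.star_def, Complex.conj_I]
    linear_combination (-ρ (star c * c)) * Complex.I_mul_I
  rw [e1] at h1
  rw [e2] at h2
  simp at h1 h2
  apply Complex.ext
  · simp; linarith
  · simp; linarith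

/-- Cauchy-Schwarz for positive functionals. -/
theorem pos_cs (ρ : WeakDual ℂ 𝒰) (h : ∀ b : 𝒰, 0 ≤ ρ (star b * b)) (b c : 𝒰) :
    ‖ρ (star b * c)‖ ^ 2 ≤ (ρ (star b * b)).re * (ρ (star c * c)).re := by
  let core : PreInnerProductSpace.Core ℂ 𝒰 :=
    { inner := fun x y => ρ (star x * y)
      conj_inner_symm := fun x y => pos_herm ρ h _ _
      re_inner_nonneg := fun x => (Complex.nonneg_iff.1 (h x)).1
      add_left := fun x y z => by simp [add_mul]
      smul_left := fun x y r => by simp }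
  have := @InnerProductSpace.Core.inner_mul_inner_self_le ℂ 𝒰 _ _ _ core b c
  have e : ‖ρ (star c * b)‖ = ‖ρ (star b * c)‖ := by
    rw [← pos_herm ρ h b c, RCLike.norm_conj]
  change ‖ρ (star b * c)‖ * ‖ρ (star c * b)‖ ≤ (ρ (star b * b)).re * (ρ (star c * c)).re at this
  rw [e] at this
  rw [sq]; exact this

theorem state_norm_le {ρ : WeakDual ℂ 𝒰} (h : ρ ∈ stateSpace 𝒰) (b : 𝒰) : ‖ρ b‖ ≤ ‖b‖ := by
  let _ : PartialOrder 𝒰 := CStarAlgebra.spectralOrder 𝒰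
  have _ : StarOrderedRing 𝒰 := CStarAlgebra.spectralOrderedRing 𝒰
  have h1 := pos_cs ρ h.2 1 b
  have hle : star b * b ≤ algebraMap ℝ 𝒰 (‖b‖ ^ 2) := CStarAlgebra.star_mul_le_algebraMap_norm_sq
  obtain ⟨c, hc⟩ := CStarAlgebra.nonneg_iff_eq_star_mul_self.1 (sub_nonneg.2 hle)
  have h2 := h.2 c
  rw [← hc, map_sub] at h2
  have e : ρ (algebraMap ℝ 𝒰 (‖b‖ ^ 2)) = ((‖b‖ ^ 2 : ℝ) : ℂ) := by
    have : algebraMap ℝ 𝒰 (‖b‖ ^ 2) = ((‖b‖ ^ 2 : ℝ) : ℂ) • (1 : 𝒰) := by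
      rw [Algebra.algebraMap_eq_smul_one, Complex.coe_smul]
    rw [this, map_smul, h.1]; simp
  rw [e] at h2
  have h3 := (Complex.nonneg_iff.1 h2).1
  simp only [Complex.sub_re, Complex.ofReal_re] at h3
  simp only [star_one, one_mul, h.1, Complex.one_re] at h1
  exact (sq_le_sq₀ (norm_nonneg _) (norm_nonneg _)).1 (by linarith)

/-- If a state takes value one on a projection, it is supported there. -/
theorem state_compress {ρ : WeakDual ℂ 𝒰} (h : ρ ∈ stateSpace 𝒰) {P : 𝒰} (hs : star P = P)
    (hP : P * P = P) (h1 : ρ P = 1) (B : 𝒰) : ρ (P * B * P) = ρ B := by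
  have hz : ρ (star (1 - P) * (1 - P)) = 0 := by
    have : star (1 - P) * (1 - P) = 1 - P := by
      simp [hs, sub_mul, mul_sub, hP]
    rw [this, map_sub, h.1, h1, sub_self]
  have k1 : ∀ B, ρ ((1 - P) * B) = 0 := fun B => by
    have := pos_cs ρ h.2 (1 - P) B
    rw [hz] at this
    simp only [star_sub, star_one, hs, Complex.zero_re, zero_mul] at this
    have := pow_eq_zero_iff (two_ne_zero) |>.1 (le_antisymm this (sq_nonneg _))
    simpa using this
  have k2 : ∀ B, ρ (B * (1 - P)) = 0 := fun B => by
    have := pos_cs ρ h.2 (star B) (1 - P)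
    rw [hz] at this
    simp only [star_star, Complex.zero_re, mul_zero] at this
    have := pow_eq_zero_iff (two_ne_zero) |>.1 (le_antisymm this (sq_nonneg _))
    simpa using this
  have a1 := k1 B
  have a2 := k2 (P * B)
  simp only [sub_mul, mul_sub, one_mul, mul_one, map_sub] at a1 a2
  rw [sub_eq_zero] at a1 a2
  rw [← a2, ← a1]

theorem state_proj_le {ρ : WeakDual ℂ 𝒰} (h : ρ ∈ stateSpace 𝒰) {P : 𝒰} (hs : star P = P)
    (hP : P * P = P) : (ρ P).re ≤ 1 ∧ (ρ P).im = 0 := by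
  have h1 := h.2 P
  have h2 := h.2 (1 - P)
  have : star (1 - P) * (1 - P) = 1 - P := by
    simp [hs, sub_mul, mul_sub, hP]
  rw [this, map_sub, h.1] at h2
  rw [hs, hP] at h1
  have := (Complex.nonneg_iff.1 h2).1
  simp at this
  exact ⟨this, (Complex.nonneg_iff.1 h1).2.symm⟩

/-- The even states. -/
def evenStates (σ : 𝒰 ≃⋆ₐ[ℂ] 𝒰) : Set (WeakDual ℂ 𝒰) :=
  {ρ ∈ stateSpace 𝒰 | ∀ A : 𝒰, ρ (σ A) = ρ A}

theorem evenStates_closed (σ : 𝒰 ≃⋆ₐ[ℂ] 𝒰) : IsClosed (evenStates σ) := by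
  have hc : ∀ b : 𝒰, Continuous (fun ρ : WeakDual ℂ 𝒰 => ρ b) := fun b => WeakDual.eval_continuous b
  have : evenStates σ = {ρ | ρ 1 = 1} ∩ (⋂ b : 𝒰, {ρ | 0 ≤ ρ (star b * b)}) ∩
      (⋂ b : 𝒰, {ρ | ρ (σ b) = ρ b}) := by
    ext ρ; simp [evenStates, stateSpace]
  rw [this]
  refine ((isClosed_eq (hc _) continuous_const).inter (isClosed_iInter fun b => ?_)).inter
    (isClosed_iInter fun b => isClosed_eq (hc _) (hc _))
  exact isClosed_Ici.preimage (hc (star b * b))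

theorem evenStates_compact (σ : 𝒰 ≃⋆ₐ[ℂ] 𝒰) : IsCompact (evenStates σ) := by
  refine WeakDual.isCompact_of_bounded_of_closed ?_ (evenStates_closed σ)
  refine (WeakDual.isBounded_closedBall (𝕜 := ℂ) (E := 𝒰) 0 1).subset ?_
  intro ρ hρ
  simp only [Set.mem_preimage, mem_closedBall_zero_iff]
  refine ContinuousLinearMap.opNorm_le_bound _ zero_le_one fun b => ?_
  rw [one_mul]
  exact state_norm_le hρ.1 b

theorem exists_extreme (σ : 𝒰 ≃⋆ₐ[ℂ] 𝒰) {P : 𝒰} (hs : star P = P)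
    (hP : P * P = P) (hne : ∃ ρ ∈ evenStates σ, ρ P = 1) :
    ∃ ω ∈ Set.extremePoints ℝ (evenStates σ), ω P = 1 := by
  have _ : LocallyConvexSpace ℝ (WeakDual ℂ 𝒰) :=
    inferInstanceAs (LocallyConvexSpace ℝ (WeakBilin (topDualPairing ℂ 𝒰)))
  have hcl : IsClosed {ρ : WeakDual ℂ 𝒰 | ρ P = 1} :=
    isClosed_eq (WeakDual.eval_continuous P) continuous_const
  have hcomp := (evenStates_compact σ).inter_right hcl
  obtain ⟨ρ, h1, h2⟩ := hne
  obtain ⟨ω, hω⟩ := hcomp.extremePoints_nonempty ⟨ρ, h1, h2⟩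
  have hext : IsExtreme ℝ (evenStates σ) (evenStates σ ∩ {ρ : WeakDual ℂ 𝒰 | ρ P = 1}) := by
    refine ⟨Set.inter_subset_left, ?_⟩
    rintro x hx y hy z hz ⟨s, t, hs0, ht0, hst, rfl⟩
    refine ⟨hx, ?_⟩
    have hx1 := state_proj_le hx.1 hs hP
    have hy1 := state_proj_le hy.1 hs hP
    have hz1 : (s • x + t • y) P = 1 := hz.2
    have hz2 : s • x P + t • y P = 1 := hz1
    have := congrArg Complex.re hz2
    simp at this
    have h1 : (x P).re = 1 := by
      nlinarith [hx1.1, hy1.1]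
    exact Complex.ext (by simpa using h1) (by simpa using hx1.2)
  exact ⟨ω, hext.extremePoints_subset_extremePoints hω, (extremePoints_subset hω).2⟩

/-- The functional `B ↦ ρ (v* B v)`. -/
noncomputable def conjFun (ρ : WeakDual ℂ 𝒰) (v : 𝒰) : WeakDual ℂ 𝒰 :=
  StrongDual.toWeakDual ((WeakDual.toStrongDual ρ) ∘L
    (((ContinuousLinearMap.mul ℂ 𝒰).flip v) ∘L (ContinuousLinearMap.mul ℂ 𝒰 (star v))))

theorem conjFun_apply (ρ : WeakDual ℂ 𝒰) (v B : 𝒰) : conjFun ρ v B = ρ (star v * B * v) := rfl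

theorem conjFun_pos {ρ : WeakDual ℂ 𝒰} (h : ∀ b : 𝒰, 0 ≤ ρ (star b * b)) (v b : 𝒰) :
    0 ≤ conjFun ρ v (star b * b) := by
  rw [conjFun_apply]
  have := h (b * v)
  simpa [mul_assoc] using this

end States

section CAR

variable {𝒰 : Type*} [CStarAlgebra 𝒰] {ι : Type*}

/-- The star subalgebra generated by the modes in `Λ`. -/
abbrev Alg (a : ι → 𝒰) (Λ : Set ι) : StarSubalgebra ℂ 𝒰 := StarAlgebra.adjoin ℂ (a '' Λ)

/-- CAR relations with a single index, together with the parity automorphism. -/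
structure CARData (a : ι → 𝒰) (σ : 𝒰 ≃⋆ₐ[ℂ] 𝒰) : Prop where
  aa : ∀ p q, a p * a q + a q * a p = 0
  as : ∀ p q, a p * star (a q) + star (a q) * a p = if p = q then 1 else 0
  par : ∀ p, σ (a p) = - a p

theorem adj_ind {a : ι → 𝒰} {Λ : Set ι} {p : 𝒰 → Prop} (hg : ∀ r ∈ Λ, p (a r))
    (hgs : ∀ r ∈ Λ, p (star (a r))) (hc : ∀ c : ℂ, p (algebraMap ℂ 𝒰 c))
    (hadd : ∀ x y, x ∈ Alg a Λ → y ∈ Alg a Λ → p x → p y → p (x + y))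
    (hmul : ∀ x y, x ∈ Alg a Λ → y ∈ Alg a Λ → p x → p y → p (x * y))
    {B : 𝒰} (hB : B ∈ Alg a Λ) : p B := by
  have e := StarAlgebra.adjoin_toSubalgebra ℂ (a '' Λ)
  have key : ∀ x, x ∈ Algebra.adjoin ℂ (a '' Λ ∪ star (a '' Λ)) ↔ x ∈ Alg a Λ := fun x => by
    rw [← e]; rfl
  refine Algebra.adjoin_induction (p := fun x _ => p x) ?_ hc
    (fun x y hx hy => hadd x y ((key x).1 hx) ((key y).1 hy))
    (fun x y hx hy => hmul x y ((key x).1 hx) ((key y).1 hy)) ((key B).2 hB)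
  rintro x (⟨r, hr, rfl⟩ | hx)
  · exact hg r hr
  · obtain ⟨r, hr, h⟩ := hx
    rw [← star_star x, ← h]
    exact hgs r hr

theorem gen_mem {a : ι → 𝒰} {Λ : Set ι} {r : ι} (hr : r ∈ Λ) : a r ∈ Alg a Λ :=
  StarAlgebra.subset_adjoin ℂ _ ⟨r, hr, rfl⟩

theorem Alg_mono {a : ι → 𝒰} {Λ Λ' : Set ι} (h : Λ ⊆ Λ') : Alg a Λ ≤ Alg a Λ' :=
  StarAlgebra.adjoin_mono (Set.image_mono h)

variable {a : ι → 𝒰} {σ : 𝒰 ≃⋆ₐ[ℂ] 𝒰}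

theorem par_star (h : CARData a σ) (r : ι) : σ (star (a r)) = - star (a r) := by
  rw [map_star, h.par, star_neg]

theorem sigma_mem (h : CARData a σ) {Λ : Set ι} {B : 𝒰} (hB : B ∈ Alg a Λ) : σ B ∈ Alg a Λ := by
  refine adj_ind (p := fun B => σ B ∈ Alg a Λ) ?_ ?_ ?_ ?_ ?_ hB
  · intro r hr; rw [h.par]; exact neg_mem (gen_mem hr)
  · intro r hr; rw [par_star h]; exact neg_mem (star_mem (gen_mem hr))
  · intro c; rw [AlgHomClass.commutes σ c]; exact algebraMap_mem _ c
  · intro x y _ _ hx hy; rw [map_add]; exact add_mem hx hy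
  · intro x y _ _ hx hy; rw [map_mul]; exact mul_mem hx hy

theorem sigma_sigma (h : CARData a σ) {Λ : Set ι} {B : 𝒰} (hB : B ∈ Alg a Λ) : σ (σ B) = B := by
  refine adj_ind (p := fun B => σ (σ B) = B) ?_ ?_ ?_ ?_ ?_ hB
  · intro r hr; simp [h.par]
  · intro r hr; simp [par_star h]
  · intro c; rw [AlgHomClass.commutes σ c, AlgHomClass.commutes σ c]
  · intro x y _ _ hx hy; simp [hx, hy]
  · intro x y _ _ hx hy; simp [hx, hy]

theorem anticomm (h : CARData a σ) {Λ : Set ι} {q : ι} (hq : q ∉ Λ) {B : 𝒰} (hB : B ∈ Alg a Λ) :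
    a q * B = σ B * a q ∧ star (a q) * B = σ B * star (a q) := by
  refine adj_ind (p := fun B => a q * B = σ B * a q ∧ star (a q) * B = σ B * star (a q))
    ?_ ?_ ?_ ?_ ?_ hB
  · intro r hr
    have hne : r ≠ q := fun e => hq (e ▸ hr)
    have h1 := h.aa q r
    have h2 := h.as r q
    rw [if_neg hne] at h2
    rw [h.par, neg_mul, neg_mul]
    exact ⟨eq_neg_of_add_eq_zero_left h1, eq_neg_of_add_eq_zero_right h2⟩
  · intro r hr
    have hne : q ≠ r := fun e => hq (e ▸ hr)
    have h1 := congrArg star (h.aa r q)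
    have h2 := h.as q r
    rw [if_neg hne] at h2
    simp only [star_add, star_mul, star_zero] at h1
    rw [par_star h, neg_mul, neg_mul]
    exact ⟨eq_neg_of_add_eq_zero_left h2, eq_neg_of_add_eq_zero_left h1⟩
  · intro c
    rw [AlgHomClass.commutes σ c]
    exact ⟨(Algebra.commutes c _).symm, (Algebra.commutes c _).symm⟩
  · rintro x y _ _ ⟨hx, hx'⟩ ⟨hy, hy'⟩
    rw [map_add, mul_add, mul_add, add_mul, add_mul, hx, hy, hx', hy']
    exact ⟨rfl, rfl⟩
  · rintro x y _ _ ⟨hx, hx'⟩ ⟨hy, hy'⟩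
    rw [map_mul, ← mul_assoc, ← mul_assoc, hx, hx']
    exact ⟨by rw [mul_assoc, hy, mul_assoc], by rw [mul_assoc, hy', mul_assoc]⟩

theorem sq_zero (h : CARData a σ) (r : ι) : a r * a r = 0 := by
  have := h.aa r r
  rw [← two_smul ℂ] at this
  exact (smul_eq_zero.1 this).resolve_left two_ne_zero

theorem sq_zero' (h : CARData a σ) (r : ι) : star (a r) * star (a r) = 0 := by
  rw [← star_mul, sq_zero h, star_zero]

theorem car_one (h : CARData a σ) (r : ι) : a r * star (a r) + star (a r) * a r = 1 := by
  rw [h.as, if_pos rfl]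

/-- The projection on the empty mode `r`. -/
def nn (a : ι → 𝒰) (r : ι) : 𝒰 := a r * star (a r)

theorem nn_mul_star (h : CARData a σ) (r : ι) : nn a r * star (a r) = 0 := by
  rw [nn, mul_assoc, sq_zero' h, mul_zero]

theorem mul_nn (h : CARData a σ) (r : ι) : a r * nn a r = 0 := by
  rw [nn, ← mul_assoc, sq_zero h, zero_mul]

theorem nn_mul (h : CARData a σ) (r : ι) : nn a r * a r = a r := by
  have h1 := car_one h r
  have h2 := sq_zero h r
  unfold nn
  linear_combination (norm := noncomm_ring) a r * h1 - h2 * star (a r)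

theorem star_mul_nn (h : CARData a σ) (r : ι) : star (a r) * nn a r = star (a r) := by
  have h1 := car_one h r
  have h2 := sq_zero' h r
  unfold nn
  linear_combination (norm := noncomm_ring) h1 * star (a r) - a r * h2

theorem nn_star (r : ι) : star (nn a r) = nn a r := by simp [nn]

theorem nn_idem (h : CARData a σ) (r : ι) : nn a r * nn a r = nn a r := by
  change a r * star (a r) * nn a r = _
  rw [mul_assoc, star_mul_nn h]; rfl

theorem nn_par (h : CARData a σ) (r : ι) : σ (nn a r) = nn a r := by
  simp [nn, h.par, par_star h]

theorem nn_mem {Λ : Set ι} {r : ι} (hr : r ∈ Λ) : nn a r ∈ Alg a Λ :=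
  mul_mem (gen_mem hr) (star_mem (gen_mem hr))

theorem nn_comm (h : CARData a σ) {Λ : Set ι} {q : ι} (hq : q ∉ Λ) {B : 𝒰} (hB : B ∈ Alg a Λ) :
    nn a q * B = B * nn a q := by
  rw [nn, mul_assoc, (anticomm h hq hB).2, ← mul_assoc, (anticomm h hq (sigma_mem h hB)).1,
    sigma_sigma h hB, mul_assoc]

/-- The vacuum projection of a list of modes. -/
def vac (a : ι → 𝒰) : List ι → 𝒰
  | [] => 1
  | r :: L => nn a r * vac a L

theorem vac_mem (L : List ι) : vac a L ∈ Alg a {x | x ∈ L} := by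
  induction L with
  | nil => exact one_mem _
  | cons r L ih =>
    refine mul_mem (nn_mem (by simp)) (Alg_mono (fun x hx => ?_) ih)
    simp at hx ⊢; exact Or.inr hx

theorem vac_par (h : CARData a σ) (L : List ι) : σ (vac a L) = vac a L := by
  induction L with
  | nil => exact map_one σ
  | cons r L ih => rw [vac, map_mul, nn_par h, ih]

theorem vac_comm (h : CARData a σ) {Λ : Set ι} {L : List ι} (hL : ∀ x ∈ L, x ∉ Λ) {B : 𝒰}
    (hB : B ∈ Alg a Λ) : vac a L * B = B * vac a L := by
  induction L with
  | nil => simp [vac]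
  | cons r L ih =>
    rw [vac, mul_assoc, ih (fun x hx => hL x (by simp [hx])), ← mul_assoc,
      nn_comm h (hL r (by simp)) hB, mul_assoc]

theorem nn_vac (h : CARData a σ) {r : ι} {L : List ι} (hr : r ∉ L) :
    nn a r * vac a L = vac a L * nn a r := nn_comm h (Λ := {x | x ∈ L}) hr (vac_mem L)

theorem vac_star (h : CARData a σ) {L : List ι} (hL : L.Nodup) : star (vac a L) = vac a L := by
  induction L with
  | nil => simp [vac]
  | cons r L ih =>
    rw [List.nodup_cons] at hL
    rw [vac, star_mul, nn_star, ih hL.2, nn_vac h hL.1]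

theorem vac_idem (h : CARData a σ) {L : List ι} (hL : L.Nodup) : vac a L * vac a L = vac a L := by
  induction L with
  | nil => simp [vac]
  | cons r L ih =>
    rw [List.nodup_cons] at hL
    have h1 := nn_vac h hL.1
    have h2 := nn_idem h r
    have h3 := ih hL.2
    rw [vac]
    linear_combination (norm := noncomm_ring) (-nn a r) * h1 * vac a L + h2 * vac a L * vac a L
      + nn a r * h3

theorem vac_append (L M : List ι) : vac a (L ++ M) = vac a L * vac a M := by
  induction L with
  | nil => simp [vac]
  | cons r L ih => rw [List.cons_append, vac, ih, vac, mul_assoc]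

theorem vac_absorb (h : CARData a σ) {L : List ι} (hL : L.Nodup) {r : ι} (hr : r ∈ L) :
    vac a L * nn a r = vac a L := by
  induction L with
  | nil => simp at hr
  | cons s L ih =>
    rw [List.nodup_cons] at hL
    rw [vac]
    rcases List.mem_cons.1 hr with rfl | hr
    · rw [nn_vac h hL.1, mul_assoc, nn_idem h]
    · rw [mul_assoc, ih hL.2 hr]

theorem vac_state (h : CARData a σ) {ρ : WeakDual ℂ 𝒰} (hρ : ρ ∈ evenStates σ) {L : List ι}
    (hL : L.Nodup) : ∃ φ ∈ evenStates σ, φ (vac a L) = 1 := by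
  induction L with
  | nil => exact ⟨ρ, hρ, hρ.1.1⟩
  | cons r L ih =>
    rw [List.nodup_cons] at hL
    obtain ⟨φ, hφ, h1⟩ := ih hL.2
    have hap : ∀ B, (conjFun φ (nn a r) + conjFun φ (a r)) B =
        φ (nn a r * B * nn a r) + φ (star (a r) * B * a r) := fun B => by
      conv_rhs => rw [← nn_star]
      rw [nn_star]
      change conjFun φ (nn a r) B + conjFun φ (a r) B = _
      rw [conjFun_apply, conjFun_apply, nn_star]
    refine ⟨conjFun φ (nn a r) + conjFun φ (a r), ⟨⟨?_, fun b => ?_⟩, fun B => ?_⟩, ?_⟩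
    · rw [hap, mul_one, mul_one, nn_idem h, nn, ← map_add, car_one h, hφ.1.1]
    · exact add_nonneg (conjFun_pos hφ.1.2 _ _) (conjFun_pos hφ.1.2 _ _)
    · rw [hap, hap, ← hφ.2 (nn a r * B * nn a r), ← hφ.2 (star (a r) * B * a r)]
      simp [nn_par h, h.par, par_star h]
    · rw [hap, vac, ← map_add, ← h1]
      congr 1
      have h1 := nn_vac h hL.1
      have h2 := nn_idem h r
      have h3 := star_mul_nn h r
      have h4 := car_one h r
      have h5 := anticomm h (Λ := {x | x ∈ L}) hL.1 (vac_mem L)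
      rw [vac_par h] at h5
      have h6 := h5.2
      have e1 : nn a r * (nn a r * vac a L) * nn a r = vac a L * nn a r := by
        linear_combination (norm := noncomm_ring) h2 * vac a L * nn a r + h1 * nn a r
          + vac a L * h2
      have e2 : star (a r) * (nn a r * vac a L) * a r = vac a L * (star (a r) * a r) := by
        linear_combination (norm := noncomm_ring) h3 * vac a L * a r + h6 * a r
      rw [e1, e2, ← mul_add, nn, h4, mul_one]

theorem decomp (h : CARData a σ) {Λ : Set ι} {r : ι} (hr : r ∉ Λ) {B : 𝒰}
    (hB : B ∈ Alg a (insert r Λ)) : ∃ B0 ∈ Alg a Λ, ∃ B1 ∈ Alg a Λ, ∃ B2 ∈ Alg a Λ,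
      ∃ B3 ∈ Alg a Λ, B = B0 + B1 * a r + star (a r) * B2 + star (a r) * B3 * a r := by
  let D : 𝒰 → Prop := fun B => ∃ B0 ∈ Alg a Λ, ∃ B1 ∈ Alg a Λ, ∃ B2 ∈ Alg a Λ,
      ∃ B3 ∈ Alg a Λ, B = B0 + B1 * a r + star (a r) * B2 + star (a r) * B3 * a r
  have hz := zero_mem (Alg a Λ)
  have hAA : ∀ s, (s ∈ Alg a Λ) → ∀ x, D x → D (s * x) := by
    rintro s hs x ⟨B0, m0, B1, m1, B2, m2, B3, m3, rfl⟩
    refine ⟨s * B0, mul_mem hs m0, s * B1, mul_mem hs m1, σ s * B2, mul_mem (sigma_mem h hs) m2,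
      σ s * B3, mul_mem (sigma_mem h hs) m3, ?_⟩
    have h1 := (anticomm h hr (sigma_mem h hs)).2
    rw [sigma_sigma h hs] at h1
    linear_combination (norm := noncomm_ring) (-h1) * B2 - h1 * B3 * a r
  have key : ∀ x, D x → D (B * x) := by
    refine adj_ind (p := fun B => ∀ x, D x → D (B * x)) ?_ ?_ ?_ ?_ ?_ hB
    · rintro s (rfl | hs)
      · rintro x ⟨B0, m0, B1, m1, B2, m2, B3, m3, rfl⟩
        refine ⟨B2, m2, σ B0 + B3, add_mem (sigma_mem h m0) m3, 0, hz, -σ B2,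
          neg_mem (sigma_mem h m2), ?_⟩
        have h0 := (anticomm h hr m0).1
        have h1 := (anticomm h hr m1).1
        have h2 := (anticomm h hr m2).1
        have hs := sq_zero h s
        have hc := car_one h s
        linear_combination (norm := noncomm_ring) h0 + h1 * a s + σ B1 * hs + hc * B2
          - star (a s) * h2 + hc * B3 * a s - star (a s) * (anticomm h hr m3).1 * a s
          - star (a s) * σ B3 * hs
      · exact hAA _ (gen_mem hs)
    · rintro s (rfl | hs)
      · rintro x ⟨B0, m0, B1, m1, B2, m2, B3, m3, rfl⟩
        refine ⟨0, hz, 0, hz, B0, m0, B1, m1, ?_⟩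
        have hs := sq_zero' h s
        linear_combination (norm := noncomm_ring) hs * B2 + hs * B3 * a s
      · exact hAA _ (star_mem (gen_mem hs))
    · intro c
      exact hAA _ (algebraMap_mem _ c)
    · rintro x y _ _ hx hy z hz
      obtain ⟨B0, m0, B1, m1, B2, m2, B3, m3, e⟩ := hx z hz
      obtain ⟨C0, n0, C1, n1, C2, n2, C3, n3, e'⟩ := hy z hz
      refine ⟨B0 + C0, add_mem m0 n0, B1 + C1, add_mem m1 n1, B2 + C2, add_mem m2 n2,
        B3 + C3, add_mem m3 n3, ?_⟩
      rw [add_mul, e, e']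
      noncomm_ring
    · rintro x y _ _ hx hy z hz
      rw [mul_assoc]
      exact hx _ (hy z hz)
  have := key 1 ⟨1, one_mem _, 0, hz, 0, hz, 0, hz, by simp⟩
  rwa [mul_one] at this

theorem mem_cons_set (r : ι) (L : List ι) : {x | x ∈ r :: L} = insert r {x | x ∈ L} := by
  ext x; simp

theorem vac_min (h : CARData a σ) {L : List ι} (hL : L.Nodup) {B : 𝒰}
    (hB : B ∈ Alg a {x | x ∈ L}) : ∃ c : ℂ, vac a L * B * vac a L = c • vac a L := by
  induction L generalizing B with
  | nil =>
    refine adj_ind (p := fun B => ∃ c : ℂ, vac a [] * B * vac a [] = c • vac a []) ?_ ?_ ?_ ?_ ?_ hB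
    · simp
    · simp
    · intro c; exact ⟨c, by simp [vac, Algebra.algebraMap_eq_smul_one]⟩
    · rintro x y _ _ ⟨c, hc⟩ ⟨d, hd⟩
      exact ⟨c + d, by rw [mul_add, add_mul, hc, hd, add_smul]⟩
    · rintro x y _ _ ⟨c, hc⟩ ⟨d, hd⟩
      simp only [vac, one_mul, mul_one] at hc hd
      exact ⟨c * d, by
        simp only [vac, one_mul, mul_one]; rw [hc, hd, smul_mul_smul_comm, one_mul]⟩
  | cons r L ih =>
    rw [List.nodup_cons] at hL
    rw [mem_cons_set] at hB
    obtain ⟨B0, m0, B1, m1, B2, m2, B3, m3, rfl⟩ := decomp h (Λ := {x | x ∈ L}) hL.1 hB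
    obtain ⟨c, hc⟩ := ih hL.2 m0
    refine ⟨c, ?_⟩
    have h1 := nn_vac h hL.1
    have h2 := nn_idem h r
    have h3 := mul_nn h r
    have h4 := nn_mul_star h r
    have hB0 := nn_comm h (Λ := {x | x ∈ L}) hL.1 m0
    rw [vac]
    have k1 : a r * (nn a r * vac a L) = 0 := by rw [← mul_assoc, h3, zero_mul]
    have k2 : nn a r * vac a L * star (a r) = 0 := by rw [h1, mul_assoc, h4, mul_zero]
    have k3 : nn a r * vac a L * B0 * (nn a r * vac a L) = nn a r * (vac a L * B0 * vac a L) := by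
      linear_combination (norm := noncomm_ring) (-nn a r * vac a L) * hB0 * vac a L
        - nn a r * h1 * B0 * vac a L + h2 * vac a L * B0 * vac a L
    rw [hc, mul_smul_comm] at k3
    rw [← k3]
    linear_combination (norm := noncomm_ring) nn a r * vac a L * B1 * k1
      + k2 * B2 * nn a r * vac a L + nn a r * vac a L * star (a r) * B3 * k1

theorem resolution (h : CARData a σ) {L : List ι} (hL : L.Nodup) :
    ∃ (κ : Type) (_ : Fintype κ) (E : κ → 𝒰), (∀ i, E i ∈ Alg a {x | x ∈ L}) ∧
      (∀ i, σ (E i) = E i ∨ σ (E i) = - E i) ∧ ∑ i, E i * vac a L * star (E i) = 1 := by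
  induction L with
  | nil => exact ⟨Unit, inferInstance, fun _ => 1, fun _ => one_mem _, fun _ => by simp, by simp [vac]⟩
  | cons r L ih =>
    rw [List.nodup_cons] at hL
    obtain ⟨κ, _, E, hE, hp, hs⟩ := ih hL.2
    have hE' : ∀ i, E i ∈ Alg a {x | x ∈ r :: L} := fun i =>
      Alg_mono (fun x hx => by simp at hx ⊢; exact Or.inr hx) (hE i)
    refine ⟨κ ⊕ κ, inferInstance, Sum.elim E (fun i => star (a r) * E i), ?_, ?_, ?_⟩
    · rintro (i | i)
      · exact hE' i
      · exact mul_mem (star_mem (gen_mem (by simp))) (hE' i)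
    · rintro (i | i)
      · exact hp i
      · simp only [Sum.elim_inr, map_mul, par_star h]
        rcases hp i with e | e <;> simp [e]
    · rw [Fintype.sum_sum_type]
      simp only [Sum.elim_inl, Sum.elim_inr, vac]
      have e1 : ∀ i, E i * (nn a r * vac a L) * star (E i) = nn a r * (E i * vac a L * star (E i)) := by
        intro i
        rw [← mul_assoc, ← nn_comm h (Λ := {x | x ∈ L}) hL.1 (hE i)]
        simp only [mul_assoc]
      have e2 : ∀ i, star (a r) * E i * (nn a r * vac a L) * star (star (a r) * E i) =
          star (a r) * (E i * vac a L * star (E i)) * a r := by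
        intro i
        have := nn_comm h (Λ := {x | x ∈ L}) hL.1 (hE i)
        have h3 := star_mul_nn h r
        rw [star_mul, star_star]
        linear_combination (norm := noncomm_ring)
          (-star (a r)) * this * vac a L * star (E i) * a r + h3 * E i * vac a L * star (E i) * a r
      simp only [e1, e2]
      rw [← Finset.mul_sum, ← Finset.sum_mul, ← Finset.mul_sum, hs, mul_one, mul_one, nn, car_one h]

end CAR

section Purify

variable {𝒰 : Type*} [CStarAlgebra 𝒰] {ι : Type*}

open MatrixOrder in
theorem psd_factor {κ : Type} [Fintype κ] {G : Matrix κ κ ℂ} (hG : G.PosSemidef) :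
    ∃ W : Matrix κ κ ℂ, G = W.conjTranspose * W := by
  obtain ⟨W, hW⟩ := CStarAlgebra.nonneg_iff_eq_star_mul_self.mp hG.nonneg
  exact ⟨W, hW⟩

theorem gram {κ : Type} [Fintype κ] {ρ : WeakDual ℂ 𝒰} (hρ : ∀ b : 𝒰, 0 ≤ ρ (star b * b))
    (E : κ → 𝒰) {p : 𝒰} (hps : star p = p) (hpp : p * p = p)
    (hE : ∑ i, E i * p * star (E i) = 1) :
    ∃ W : Matrix κ κ ℂ, ∀ B : 𝒰, (∀ i j, ∃ c : ℂ, p * (star (E i) * B * E j) * p = c • p) →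
      ∑ k, p * (star (∑ j, W k j • E j) * B * (∑ j, W k j • E j)) * p = ρ B • p := by
  let G : Matrix κ κ ℂ := fun i j => ρ (E i * p * star (E j))
  have hfac : ∀ x y : 𝒰, x * p * star y = star (p * star x) * (p * star y) := fun x y => by
    rw [star_mul, star_star, hps]
    linear_combination (norm := noncomm_ring) (-x) * hpp * star y
  have hG : G.PosSemidef := by
    refine .of_dotProduct_mulVec_nonneg ?_ fun x => ?_
    · ext i j
      rw [Matrix.conjTranspose_apply]
      change starRingEnd ℂ (ρ (E j * p * star (E i))) = ρ (E i * p * star (E j))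
      rw [hfac, hfac]
      exact pos_herm ρ hρ _ _
    · have : star x ⬝ᵥ G.mulVec x = ρ (star (p * star (∑ i, star (x i) • E i)) *
          (p * star (∑ i, star (x i) • E i))) := by
        rw [← hfac]
        simp only [dotProduct, Matrix.mulVec, star_sum, star_smul, star_star, Finset.sum_mul,
          Finset.mul_sum, map_sum, smul_mul_assoc, mul_smul_comm, map_smul, smul_eq_mul, G,
          Pi.star_apply]
        rw [Finset.sum_comm]
        refine Finset.sum_congr rfl fun j _ => Finset.sum_congr rfl fun i _ => ?_
        ring
      rw [this]
      exact hρ _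
  obtain ⟨W, hW⟩ := psd_factor hG
  refine ⟨W, fun B hB => ?_⟩
  choose c hc using hB
  have hBexp : B = ∑ i, ∑ j, c i j • (E i * p * star (E j)) := by
    calc B = (∑ i, E i * p * star (E i)) * B * (∑ i, E i * p * star (E i)) := by simp [hE]
      _ = ∑ i, ∑ j, (E i * p * star (E i)) * B * (E j * p * star (E j)) := by
        simp only [Finset.sum_mul, Finset.mul_sum]
        rw [Finset.sum_comm]
      _ = _ := by
        refine Finset.sum_congr rfl fun i _ => Finset.sum_congr rfl fun j _ => ?_
        have := hc i j
        calc _ = E i * (p * (star (E i) * B * E j) * p) * star (E j) := by noncomm_ring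
          _ = _ := by rw [this]; simp only [mul_smul_comm, smul_mul_assoc]
  have hρB : ρ B = ∑ i, ∑ j, c i j * G i j := by
    conv_lhs => rw [hBexp]
    simp only [map_sum, map_smul, smul_eq_mul, G]
  have hGW : ∀ i j, G i j = ∑ k, star (W k i) * W k j := fun i j => by
    rw [hW]; simp [Matrix.mul_apply]
  have hterm : ∀ k, p * (star (∑ j, W k j • E j) * B * (∑ j, W k j • E j)) * p =
      (∑ i, ∑ j, star (W k i) * W k j * c i j) • p := fun k => by
    simp only [star_sum, star_smul, Finset.sum_mul, Finset.mul_sum, smul_mul_assoc, mul_smul_comm,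
      hc, Finset.sum_smul, Finset.smul_sum, smul_smul]
    rw [Finset.sum_comm]
    refine Finset.sum_congr rfl fun i _ => Finset.sum_congr rfl fun j _ => ?_
    congr 1; ring
  simp only [hterm]
  rw [← Finset.sum_smul, hρB]
  congr 1
  rw [Finset.sum_comm]
  refine Finset.sum_congr rfl fun i _ => ?_
  rw [Finset.sum_comm]
  refine Finset.sum_congr rfl fun j _ => ?_
  rw [hGW, Finset.mul_sum]
  refine Finset.sum_congr rfl fun k _ => ?_
  ring

variable {a : ι → 𝒰} {σ : 𝒰 ≃⋆ₐ[ℂ] 𝒰}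

/-- The odd self-adjoint unitary attached to a mode. -/
def zz (a : ι → 𝒰) (r : ι) : 𝒰 := a r + star (a r)

theorem zz_star (r : ι) : star (zz a r) = zz a r := by simp [zz, add_comm]

theorem zz_sq (h : CARData a σ) (r : ι) : zz a r * zz a r = 1 := by
  unfold zz
  linear_combination (norm := noncomm_ring) sq_zero h r + sq_zero' h r + car_one h r

theorem zz_par (h : CARData a σ) (r : ι) : σ (zz a r) = - zz a r := by
  simp [zz, h.par, par_star h, add_comm]

theorem zz_mem {Λ : Set ι} {r : ι} (hr : r ∈ Λ) : zz a r ∈ Alg a Λ :=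
  add_mem (gen_mem hr) (star_mem (gen_mem hr))

theorem zz_anti (h : CARData a σ) {Λ : Set ι} {q : ι} (hq : q ∉ Λ) {B : 𝒰} (hB : B ∈ Alg a Λ) :
    zz a q * B = σ B * zz a q := by
  rw [zz, add_mul, mul_add, (anticomm h hq hB).1, (anticomm h hq hB).2]

theorem nn_zz_nn (h : CARData a σ) (r : ι) : nn a r * zz a r * nn a r = 0 := by
  unfold zz
  linear_combination (norm := noncomm_ring) nn a r * mul_nn h r + nn_mul_star h r * nn a r

theorem vac_zz (h : CARData a σ) {M : List ι} (hM : M.Nodup) {i j : ι} (hi : i ∈ M)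
    (hij : i ≠ j) : vac a M * zz a i * zz a j * vac a M = 0 := by
  have h1 := vac_absorb h hM hi
  have h2 : nn a i * vac a M = vac a M := by
    have := congrArg star h1
    rwa [star_mul, nn_star, vac_star h hM] at this
  have h3 : nn a i * zz a j = zz a j * nn a i :=
    nn_comm h (Λ := {j}) (by simpa using hij) (zz_mem rfl)
  have h4 := nn_zz_nn h i
  calc _ = (vac a M * nn a i) * zz a i * zz a j * (nn a i * vac a M) := by rw [h1, h2]
    _ = vac a M * nn a i * zz a i * (zz a j * nn a i) * vac a M := by noncomm_ring
    _ = vac a M * (nn a i * zz a i * nn a i) * zz a j * vac a M := by rw [← h3]; noncomm_ring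
    _ = 0 := by rw [h4]; simp

/-- Even resolution of the identity using an auxiliary mode. -/
theorem even_resolution (h : CARData a σ) {L : List ι} (hL : L.Nodup) {c₀ : ι} (hc₀ : c₀ ∉ L) :
    ∃ (κ : Type) (_ : Fintype κ) (E : κ → 𝒰), (∀ i, E i ∈ Alg a {x | x ∈ c₀ :: L}) ∧
      (∀ i, σ (E i) = E i) ∧ ∑ i, E i * vac a L * star (E i) = 1 ∧
      ∀ B ∈ Alg a {x | x ∈ L}, σ B = B →
        ∀ i j, ∃ c : ℂ, vac a L * (star (E i) * B * E j) * vac a L = c • vac a L := by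
  obtain ⟨κ, _, E, hE, hp, hs⟩ := resolution h hL
  have hE' : ∀ i, E i ∈ Alg a {x | x ∈ c₀ :: L} := fun i =>
    Alg_mono (fun x hx => by simp at hx ⊢; exact Or.inr hx) (hE i)
  have hzmem : zz a c₀ ∈ Alg a {x | x ∈ c₀ :: L} := zz_mem (by simp)
  have hzp := zz_anti h (Λ := {x | x ∈ L}) hc₀ (vac_mem L)
  rw [vac_par h] at hzp
  have hz2 := zz_sq h c₀
  have hneg : ∀ i, ¬ σ (E i) = E i → σ (E i) = - E i := fun i hi => (hp i).resolve_left hi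
  refine ⟨κ, inferInstance, fun i => if σ (E i) = E i then E i else E i * zz a c₀, ?_, ?_, ?_, ?_⟩
  · intro i
    dsimp only
    split_ifs
    · exact hE' i
    · exact mul_mem (hE' i) hzmem
  · intro i
    dsimp only
    split_ifs with hi
    · exact hi
    · rw [map_mul, zz_par h, hneg i hi, neg_mul_neg]
  · rw [← hs]
    refine Finset.sum_congr rfl fun i _ => ?_
    dsimp only
    split_ifs with hi
    · rfl
    · rw [star_mul, zz_star]
      linear_combination (norm := noncomm_ring) E i * hzp * zz a c₀ * star (E i)
        + E i * vac a L * hz2 * star (E i)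
  · intro B hB hBe i j
    have hT : star (E i) * B * E j ∈ Alg a {x | x ∈ L} :=
      mul_mem (mul_mem (star_mem (hE i)) hB) (hE j)
    have hσT : σ (star (E i) * B * E j) = star (σ (E i)) * B * σ (E j) := by
      rw [map_mul, map_mul, hBe, map_star]
    have hzT := zz_anti h (Λ := {x | x ∈ L}) hc₀ hT
    obtain ⟨c, hc⟩ := vac_min h hL hT
    have hodd : σ (star (E i) * B * E j) = - (star (E i) * B * E j) →
        vac a L * (star (E i) * B * E j) * vac a L = 0 := fun ho => by
      have h1 := congrArg σ hc
      rw [map_mul, map_mul, map_smul, vac_par h, ho, mul_neg, neg_mul, ← hc] at h1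
      have h2 : (2 : ℂ) • (vac a L * (star (E i) * B * E j) * vac a L) = 0 := by
        rw [two_smul]; nth_rewrite 1 [← h1]; exact neg_add_cancel _
      exact (smul_eq_zero.1 h2).resolve_left two_ne_zero
    dsimp only
    generalize hTdef : star (E i) * B * E j = T at *
    split_ifs with hi hj hj
    · rw [hTdef]; exact ⟨c, hc⟩
    · have hTo := hodd (by rw [hσT, hi, hneg j hj, mul_neg, hTdef])
      refine ⟨0, ?_⟩
      have : star (E i) * B * (E j * zz a c₀) = T * zz a c₀ := by rw [← hTdef]; noncomm_ring
      rw [this, zero_smul]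
      linear_combination (norm := noncomm_ring) vac a L * T * hzp + hTo * zz a c₀
    · have hTn : σ T = - T := by rw [hσT, hj, hneg i hi, star_neg, neg_mul, neg_mul, hTdef]
      have hTo := hodd hTn
      refine ⟨0, ?_⟩
      have : star (E i * zz a c₀) * B * E j = zz a c₀ * T := by
        rw [← hTdef, star_mul, zz_star]; noncomm_ring
      rw [this, zero_smul, hzT, hTn]
      linear_combination (norm := noncomm_ring) (-vac a L) * T * hzp - hTo * zz a c₀
    · have hTn : σ T = T := by
        rw [hσT, hneg j hj, hneg i hi, star_neg, neg_mul, neg_mul_neg, hTdef]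
      refine ⟨c, ?_⟩
      have : star (E i * zz a c₀) * B * (E j * zz a c₀) = zz a c₀ * T * zz a c₀ := by
        rw [← hTdef, star_mul, zz_star]; noncomm_ring
      rw [this, hzT, hTn, mul_assoc T, hz2, mul_one, hc]

theorem purify [Infinite ι] (h : CARData a σ) {ρ : WeakDual ℂ 𝒰} (hρ : ρ ∈ evenStates σ)
    {L : List ι} (hL : L.Nodup) :
    ∃ P : 𝒰, star P = P ∧ P * P = P ∧ (∃ ω ∈ evenStates σ, ω P = 1) ∧
      ∀ B ∈ Alg a {x | x ∈ L}, σ B = B → P * B * P = ρ B • P := by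
  obtain ⟨c₀, hc₀⟩ := Infinite.exists_notMem_finset L.toFinset
  rw [List.mem_toFinset] at hc₀
  obtain ⟨κ, _, E, hE, hEp, hEs, hEB⟩ := even_resolution h hL hc₀
  obtain ⟨W, hW⟩ := gram hρ.1.2 E (vac_star h hL) (vac_idem h hL) hEs
  -- fresh modes
  obtain ⟨m, hmi, hm⟩ : ∃ m : κ → ι, Function.Injective m ∧ ∀ k, m k ∉ c₀ :: L := by
    have hinf : Set.Infinite {x | x ∈ c₀ :: L}ᶜ := (List.finite_toSet _).infinite_compl
    let e := hinf.natEmbedding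
    let f := Fintype.equivFin κ
    refine ⟨fun k => (e (f k : ℕ)).1, ?_, fun k => (e (f k : ℕ)).2⟩
    intro k l hkl
    exact f.injective (Fin.ext (e.injective (Subtype.ext hkl)))
  let M : List ι := (Finset.univ : Finset κ).toList.map m
  have hM : M.Nodup := (Finset.nodup_toList _).map hmi
  have hMm : ∀ k, m k ∈ M := fun k => List.mem_map.2 ⟨k, by simp, rfl⟩
  have hMd : ∀ x ∈ M, x ∉ {x | x ∈ c₀ :: L} := by
    intro x hx
    obtain ⟨k, _, rfl⟩ := List.mem_map.1 hx
    exact hm k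
  have hsub : {x | x ∈ L} ⊆ {x | x ∈ c₀ :: L} := fun x hx => by simp at hx ⊢; exact Or.inr hx
  have hML : (M ++ L).Nodup := hM.append hL fun x hx hx' => hMd x hx (hsub hx')
  let X : κ → 𝒰 := fun k => ∑ j, W k j • E j
  have hX : ∀ k, X k ∈ Alg a {x | x ∈ c₀ :: L} := fun k =>
    sum_mem fun j _ => SMulMemClass.smul_mem _ (hE j)
  have hXp : ∀ k, σ (X k) = X k := fun k => by simp only [X, map_sum, map_smul, hEp]
  let z : κ → 𝒰 := fun k => zz a (m k)
  let V : 𝒰 := ∑ k, X k * z k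
  let p := vac a L
  let q := vac a M
  have hpmem : p ∈ Alg a {x | x ∈ c₀ :: L} := Alg_mono hsub (vac_mem L)
  have hz : ∀ k T, T ∈ Alg a {x | x ∈ c₀ :: L} → σ T = T → z k * T = T * z k := fun k T hT hTp => by
    have := zz_anti h (hm k : m k ∉ {x | x ∈ c₀ :: L}) hT
    rwa [hTp] at this
  have hq : ∀ T, T ∈ Alg a {x | x ∈ c₀ :: L} → q * T = T * q := fun T hT => vac_comm h hMd hT
  have hqz : ∀ j k, q * z j * z k * q = if j = k then q else 0 := fun j k => by
    split_ifs with hjk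
    · subst hjk
      rw [mul_assoc q, zz_sq h, mul_one]; exact vac_idem h hM
    · exact vac_zz h hM (hMm j) (fun e => hjk (hmi e))
  have hr : vac a (M ++ L) = q * p := vac_append _ _
  have hrs := vac_star h hML
  have hri := vac_idem h hML
  have hrp := vac_par h (M ++ L)
  have hVs : star V = ∑ k, z k * star (X k) := by simp [V, star_sum, z, zz_star]
  have main : ∀ B ∈ Alg a {x | x ∈ L}, σ B = B →
      vac a (M ++ L) * (star V * B * V) * vac a (M ++ L) = ρ B • vac a (M ++ L) := by
    intro B hB hBp
    have hT : ∀ j k, star (X j) * B * X k ∈ Alg a {x | x ∈ c₀ :: L} := fun j k =>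
      mul_mem (mul_mem (star_mem (hX j)) (Alg_mono hsub hB)) (hX k)
    have hTp : ∀ j k, σ (star (X j) * B * X k) = star (X j) * B * X k := fun j k => by
      rw [map_mul, map_mul, map_star, hXp, hXp, hBp]
    have hterm : ∀ j k, q * p * (z j * star (X j) * B * (X k * z k)) * (q * p) =
        if j = k then q * (p * (star (X j) * B * X k) * p) else 0 := by
      intro j k
      have e1 : q * p * (z j * star (X j) * B * (X k * z k)) * (q * p) =
          q * z j * z k * q * (p * (star (X j) * B * X k) * p) := by
        have t1 := hz k _ (hT j k) (hTp j k)
        have t2 := hq _ (hT j k)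
        have t3 := hz j p hpmem (vac_par h L)
        have t4 := hz k p hpmem (vac_par h L)
        have t5 := hq p hpmem
        generalize hTd : star (X j) * B * X k = T at *
        have : q * p * (z j * star (X j) * B * (X k * z k)) * (q * p) =
            q * p * z j * T * z k * q * p := by rw [← hTd]; noncomm_ring
        rw [this]
        linear_combination (norm := noncomm_ring) (-q) * t3 * T * z k * q * p
          - q * z j * p * t1 * q * p - q * z j * t4 * T * q * p
          - q * z j * z k * p * t2 * p - q * z j * z k * t5 * T * p
      rw [e1, hqz]
      split_ifs <;> simp
    rw [hr, hVs]
    have : q * p * ((∑ k, z k * star (X k)) * B * V) * (q * p) =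
        ∑ j, ∑ k, q * p * (z j * star (X j) * B * (X k * z k)) * (q * p) := by
      simp only [V, Finset.sum_mul, Finset.mul_sum]
      rw [Finset.sum_comm]
    rw [this]
    simp only [hterm, Finset.sum_ite_eq, Finset.mem_univ, if_true]
    rw [← Finset.mul_sum, hW B (hEB B hB hBp), mul_smul_comm]
  have hVp : σ V = - V := by
    simp only [V, map_sum, map_mul, hXp, z, zz_par h, mul_neg, Finset.sum_neg_distrib]
  have hst := vac_state h hρ hML
  generalize vac a (M ++ L) = r at *
  have main1 := main 1 (one_mem _) (map_one σ)
  rw [hρ.1.1, one_smul, mul_one] at main1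
  obtain ⟨φ, hφ, hφr⟩ := hst
  refine ⟨V * r * star V, ?_, ?_, ⟨conjFun φ (V * r), ⟨⟨?_, conjFun_pos hφ.1.2 _⟩, ?_⟩, ?_⟩, ?_⟩
  · simp [hrs, mul_assoc]
  · linear_combination (norm := noncomm_ring) V * main1 * star V
  · rw [conjFun_apply, star_mul, hrs, ← hφr]
    congr 1
    linear_combination (norm := noncomm_ring) main1
  · intro B
    rw [conjFun_apply, conjFun_apply, ← hφ.2 (star (V * r) * B * (V * r))]
    simp [hVp, hrp, hrs, map_star]
  · rw [conjFun_apply, star_mul, hrs, ← hφr]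
    congr 1
    linear_combination (norm := noncomm_ring) main1 * star V * V * r + main1
  · intro B hB hBp
    have e : V * r * star V * B * (V * r * star V) =
      V * (r * (star V * B * V) * r) * star V := by noncomm_ring
    rw [e, main B hB hBp, mul_smul_comm, smul_mul_assoc]

theorem approx [Infinite ι] (h : CARData a σ) {ρ : WeakDual ℂ 𝒰} (hρ : ρ ∈ evenStates σ)
    (Λ : Finset ι) : ∃ ω ∈ Set.extremePoints ℝ (evenStates σ),
      ∀ B ∈ Alg a (Λ : Set ι), ω B = ρ B := by
  obtain ⟨P, hs, hP, hne, hB⟩ := purify h hρ (Finset.nodup_toList Λ)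
  obtain ⟨ω, hω, h1⟩ := exists_extreme σ hs hP hne
  refine ⟨ω, hω, fun B hBm => ?_⟩
  have hΛ : {x | x ∈ Λ.toList} = (Λ : Set ι) := by ext; simp
  rw [hΛ] at hB
  have hω' : ω ∈ evenStates σ := extremePoints_subset hω
  have hev : ∀ C ∈ Alg a (Λ : Set ι), σ C = C → ω C = ρ C := fun C hC hCp => by
    rw [← state_compress hω'.1 hs hP h1 C, hB C hC hCp, map_smul, h1, smul_eq_mul, mul_one]
  have := hev (B + σ B) (add_mem hBm (sigma_mem h hBm)) (by
    rw [map_add, sigma_sigma h hBm, add_comm])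
  rw [map_add, map_add, hω'.2, hρ.2, ← two_mul, ← two_mul] at this
  exact mul_left_cancel₀ two_ne_zero this

theorem mem_finite {B : 𝒰} (hB : B ∈ StarAlgebra.adjoin ℂ (Set.range a)) :
    ∃ Λ : Finset ι, B ∈ Alg a (Λ : Set ι) := by
  rw [← Set.image_univ] at hB
  refine adj_ind (Λ := Set.univ) (p := fun B => ∃ Λ : Finset ι, B ∈ Alg a (Λ : Set ι))
    ?_ ?_ ?_ ?_ ?_ hB
  · intro r _; exact ⟨{r}, gen_mem (by simp)⟩
  · intro r _; exact ⟨{r}, star_mem (gen_mem (by simp))⟩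
  · intro c; exact ⟨∅, algebraMap_mem _ c⟩
  · rintro x y _ _ ⟨Λ, hx⟩ ⟨Λ', hy⟩
    exact ⟨Λ ∪ Λ', add_mem (Alg_mono (by simp) hx) (Alg_mono (by simp) hy)⟩
  · rintro x y _ _ ⟨Λ, hx⟩ ⟨Λ', hy⟩
    exact ⟨Λ ∪ Λ', mul_mem (Alg_mono (by simp) hx) (Alg_mono (by simp) hy)⟩

theorem even_dense [Infinite ι] (h : CARData a σ)
    (hgen : Dense ((StarAlgebra.adjoin ℂ (Set.range a) : StarSubalgebra ℂ 𝒰) : Set 𝒰)) :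
    evenStates σ = closure (Set.extremePoints ℝ (evenStates σ)) := by
  refine Set.Subset.antisymm ?_ (closure_minimal extremePoints_subset (evenStates_closed σ))
  intro ρ hρ
  choose ω hω hωB using approx h hρ
  refine mem_closure_of_tendsto (f := ω) (b := Filter.atTop) ?_ (Filter.Eventually.of_forall hω)
  rw [tendsto_iff_forall_eval_tendsto_topDualPairing]
  intro b
  change Filter.Tendsto (fun Λ => ω Λ b) Filter.atTop (nhds (ρ b))
  rw [Metric.tendsto_atTop]
  intro ε hε
  obtain ⟨B, hB, hd⟩ := Metric.dense_iff.1 hgen b (ε / 2) (by linarith)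
  obtain ⟨Λ₀, hΛ₀⟩ := mem_finite hd
  refine ⟨Λ₀, fun Λ hΛ => ?_⟩
  have e := hωB Λ B (Alg_mono (by exact_mod_cast hΛ) hΛ₀)
  have n1 := state_norm_le (extremePoints_subset (hω Λ)).1 (b - B)
  have n2 := state_norm_le hρ.1 (b - B)
  rw [map_sub] at n1 n2
  rw [Metric.mem_ball, dist_comm, dist_eq_norm] at hB
  rw [dist_eq_norm]
  calc ‖ω Λ b - ρ b‖ = ‖(ω Λ b - ω Λ B) - (ρ b - ρ B)‖ := by rw [e]; congr 1; ring
    _ ≤ ‖ω Λ b - ω Λ B‖ + ‖ρ b - ρ B‖ := norm_sub_le _ _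
    _ < ε := by linarith

end Purify

/-- The extreme points of the set `E⁺` of even states are weak*-dense in `E⁺`. -/
theorem extreme_even_states_weakStar_dense
    {𝔏 S 𝒰 : Type*} [Infinite 𝔏] [Finite S] [Nonempty S]
    [CStarAlgebra 𝒰] [Nontrivial 𝒰] [TopologicalSpace.SeparableSpace 𝒰]
    (a : 𝔏 × S → 𝒰) (hCAR : IsCARFamily a)
    (hgen : Dense ((StarAlgebra.adjoin ℂ (Set.range a) : StarSubalgebra ℂ 𝒰) : Set 𝒰))
    (σ : 𝒰 ≃⋆ₐ[ℂ] 𝒰) (hσ : ∀ p : 𝔏 × S, σ (a p) = - a p) :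
    {ρ ∈ stateSpace 𝒰 | ∀ A : 𝒰, ρ (σ A) = ρ A} =
      closure (Set.extremePoints ℝ {ρ ∈ stateSpace 𝒰 | ∀ A : 𝒰, ρ (σ A) = ρ A}) := by
  have h : CARData a σ := by
    refine ⟨fun p q => hCAR.1 p.1 q.1 p.2 q.2, fun p q => ?_, hσ⟩
    have := hCAR.2 p.1 q.1 p.2 q.2
    simpa [Prod.ext_iff] using this
  exact even_dense h hgen
end

section
/- Let 𝔏 be a set, S a finite set, and 𝒰 a unital complex C*-algebra equipped with a CAR family a : 𝔏 × S → 𝒰 generating 𝒰 topologically, with parity automorphism σ. For Λ ⊆ 𝔏, let 𝒰_Λ denote the closure of the star-subalgebra generated by {a_{x,s} : x ∈ Λ, s ∈ S}. If Λ⁽¹⁾ and Λ⁽²⁾ are disjoint subsets of 𝔏, A₁ ∈ 𝒰_{Λ⁽¹⁾} is even (σ(A₁) = A₁), and A₂ ∈ 𝒰_{Λ⁽²⁾}, then A₁A₂ = A₂A₁. -/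
open scoped Classical

/-- The local C*-subalgebra `𝒰_Λ`: the closure of the star-subalgebra generated by the
creation/annihilation operators indexed by points of `Λ`. -/
def localAlgebra {𝔏 S 𝒰 : Type*} [CStarAlgebra 𝒰] (a : 𝔏 × S → 𝒰) (Λ : Set 𝔏) : Set 𝒰 :=
  closure ((StarAlgebra.adjoin ℂ {u : 𝒰 | ∃ x ∈ Λ, ∃ s : S, u = a (x, s)} :
    StarSubalgebra ℂ 𝒰) : Set 𝒰)

/-- Even elements localized in a region commute with arbitrary elements localized in a
disjoint region. -/
theorem even_local_elements_commute
    {𝔏 S 𝒰 : Type*} [Finite S] [CStarAlgebra 𝒰]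
    (a : 𝔏 × S → 𝒰) (hCAR : IsCARFamily a)
    (hgen : Dense ((StarAlgebra.adjoin ℂ (Set.range a) : StarSubalgebra ℂ 𝒰) : Set 𝒰))
    (σ : 𝒰 ≃⋆ₐ[ℂ] 𝒰) (hσ : ∀ p : 𝔏 × S, σ (a p) = - a p)
    (Λ₁ Λ₂ : Set 𝔏) (hdisj : Disjoint Λ₁ Λ₂)
    (A₁ A₂ : 𝒰) (hA₁ : A₁ ∈ localAlgebra a Λ₁) (heven : σ A₁ = A₁)
    (hA₂ : A₂ ∈ localAlgebra a Λ₂) :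
    A₁ * A₂ = A₂ * A₁ := by
  obtain ⟨h1, h2⟩ := hCAR
  have hne : ∀ x ∈ Λ₁, ∀ y ∈ Λ₂, x ≠ y := fun x hx y hy h =>
    Set.disjoint_left.mp hdisj hx (h ▸ hy)
  have hσc : Continuous σ := (StarAlgEquiv.isometry σ).continuous
  -- elements that anticommute with the generators of region one twist-commute with `A₁`
  have key : ∀ b : 𝒰, (∀ x ∈ Λ₁, ∀ s : S, b * a (x, s) = - a (x, s) * b) →
      (∀ x ∈ Λ₁, ∀ s : S, b * star (a (x, s)) = - star (a (x, s)) * b) →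
      b * A₁ = A₁ * b := by
    intro b hb hb'
    have hcl : IsClosed {A : 𝒰 | b * A = σ A * b} :=
      isClosed_eq (continuous_const.mul continuous_id) (hσc.mul continuous_const)
    have hsub : ((StarAlgebra.adjoin ℂ {u : 𝒰 | ∃ x ∈ Λ₁, ∃ s : S, u = a (x, s)} :
        StarSubalgebra ℂ 𝒰) : Set 𝒰) ⊆ {A : 𝒰 | b * A = σ A * b} := by
      intro A hA
      change A ∈ (StarAlgebra.adjoin ℂ {u : 𝒰 | ∃ x ∈ Λ₁, ∃ s : S, u = a (x, s)}).toSubalgebra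
        at hA
      rw [StarAlgebra.adjoin_toSubalgebra] at hA
      change b * A = σ A * b
      induction hA using Algebra.adjoin_induction with
      | mem u hu =>
        rcases hu with ⟨x, hx, s, rfl⟩ | ⟨x, hx, s, hu⟩
        · rw [hσ, hb x hx s]
        · obtain rfl : u = star (a (x, s)) := by rw [← hu, star_star]
          rw [map_star, hσ, star_neg, hb' x hx s]
      | algebraMap r =>
        rw [AlgHomClass.commutes]
        exact (Algebra.commutes r b).symm
      | add u v _ _ hu hv => rw [mul_add, map_add, add_mul, hu, hv]
      | mul u v _ _ hu hv => rw [map_mul, ← mul_assoc, hu, mul_assoc, hv, mul_assoc]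
    have := closure_minimal hsub hcl hA₁
    change b * A₁ = σ A₁ * b at this
    rwa [heven] at this
  have hcl : IsClosed {B : 𝒰 | A₁ * B = B * A₁} :=
    isClosed_eq (continuous_const.mul continuous_id) (continuous_id.mul continuous_const)
  refine closure_minimal (t := {B : 𝒰 | A₁ * B = B * A₁}) ?_ hcl hA₂
  intro B hB
  change B ∈ (StarAlgebra.adjoin ℂ {u : 𝒰 | ∃ x ∈ Λ₂, ∃ s : S, u = a (x, s)}).toSubalgebra at hB
  rw [StarAlgebra.adjoin_toSubalgebra] at hB
  change A₁ * B = B * A₁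
  induction hB using Algebra.adjoin_induction with
  | mem u hu =>
    rcases hu with ⟨y, hy, t, rfl⟩ | ⟨y, hy, t, hu⟩
    · refine (key _ (fun x hx s => ?_) (fun x hx s => ?_)).symm
      · rw [neg_mul, eq_neg_iff_add_eq_zero, h1]
      · rw [neg_mul, eq_neg_iff_add_eq_zero, h2, if_neg]
        exact fun h => hne x hx y hy h.1.symm
    · obtain rfl : u = star (a (y, t)) := by rw [← hu, star_star]
      refine (key _ (fun x hx s => ?_) (fun x hx s => ?_)).symm
      · rw [neg_mul, eq_neg_iff_add_eq_zero, add_comm, h2, if_neg]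
        exact fun h => hne x hx y hy h.1
      · rw [neg_mul, eq_neg_iff_add_eq_zero, ← star_mul, ← star_mul, ← star_add, h1, star_zero]
  | algebraMap r => exact (Algebra.commutes r A₁).symm
  | add u v _ _ hu hv => rw [mul_add, add_mul, hu, hv]
  | mul u v _ _ hu hv => rw [← mul_assoc, hu, mul_assoc, hv, mul_assoc]
end

section
/- Let 𝔏 be a set, 𝒰 a unital complex C*-algebra, and F : 𝔏 × 𝔏 → ℝ with 0 < F(x,y) ≤ 1 such that for each y ∈ 𝔏 the family (F(x,y))_{x ∈ 𝔏} is summable with sum ≤ K. Let Φ be an interaction with W-norm at most C relative to F, let Λ ⊆ 𝔏 be finite, and let A ∈ 𝒰 satisfy the locality hypothesis: Φ(Z)·A = A·Φ(Z) for every finite Z ⊆ 𝔏 with Z ∩ Λ = ∅. For a finite set S ⊆ 𝔏 define δ_S(A) := Σ_{Z ⊆ S} i·(Φ(Z)A − AΦ(Z)). Then: (i) for all finite sets S₁ ⊆ S₂ ⊆ 𝔏, ‖δ_{S₂}(A) − δ_{S₁}(A)‖ ≤ 2·|Λ|·‖A‖·C·max_{y ∈ Λ} Σ_{x ∈ 𝔏∖S₁}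 F(x,y); and (ii) for every finite set S ⊆ 𝔏, ‖δ_S(A)‖ ≤ 2·|Λ|·‖A‖·C·K. -/
/-- An interaction: a map from finite subsets of the lattice `𝔏` to `𝒰`, vanishing on the
empty set. -/
def IsInteraction {𝔏 𝒰 : Type*} [CStarAlgebra 𝒰] (Φ : Finset 𝔏 → 𝒰) : Prop :=
  Φ ∅ = 0

/-- `Φ` has `𝒲`-norm at most `C` relative to the decay function `F`: for all `x, y`, the
family of norms `‖Φ Z‖`, indexed by the finite sets `Z` containing `x` and `y`, is summable
with sum at most `C · F x y`. -/
def HasWNormLE {𝔏 𝒰 : Type*} [CStarAlgebra 𝒰] (Φ : Finset 𝔏 → 𝒰)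
    (F : 𝔏 → 𝔏 → ℝ) (C : ℝ) : Prop :=
  ∀ x y : 𝔏,
    Summable (fun Z : {Z : Finset 𝔏 // x ∈ Z ∧ y ∈ Z} => ‖Φ Z.1‖) ∧
    (∑' Z : {Z : Finset 𝔏 // x ∈ Z ∧ y ∈ Z}, ‖Φ Z.1‖) ≤ C * F x y

/-- The finite-volume derivation `δ_S(A) = ∑_{Z ⊆ S} i·(Φ(Z)A − AΦ(Z))`. -/
noncomputable def finiteVolumeDeriv {𝔏 𝒰 : Type*} [CStarAlgebra 𝒰]
    (Φ : Finset 𝔏 → 𝒰) (A : 𝒰) (S : Finset 𝔏) : 𝒰 :=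
  ∑ Z ∈ S.powerset, (Complex.I : ℂ) • (Φ Z * A - A * Φ Z)

open Classical in
theorem core_bound {𝔏 𝒰 : Type*} [CStarAlgebra 𝒰]
    (F : 𝔏 → 𝔏 → ℝ) (Φ : Finset 𝔏 → 𝒰) (C : ℝ) (hC : 0 ≤ C) (hW : HasWNormLE Φ F C)
    (Λ : Finset 𝔏) (A : 𝒰)
    (hloc : ∀ Z : Finset 𝔏, Disjoint Z Λ → Φ Z * A = A * Φ Z)
    (T : Finset (Finset 𝔏)) (X : Finset 𝔏) (hT : ∀ Z ∈ T, ∃ x ∈ X, x ∈ Z)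
    (M : ℝ) (hM : ∀ y ∈ Λ, ∑ x ∈ X, F x y ≤ M) :
    ‖∑ Z ∈ T, (Complex.I : ℂ) • (Φ Z * A - A * Φ Z)‖ ≤ 2 * Λ.card * ‖A‖ * C * M := by
  have hpt : ∀ Z ∈ T, ‖(Complex.I : ℂ) • (Φ Z * A - A * Φ Z)‖ ≤
      ∑ y ∈ Λ, ∑ x ∈ X, 2 * ‖A‖ * (if x ∈ Z ∧ y ∈ Z then ‖Φ Z‖ else 0) := by
    intro Z hZ
    have hnn : ∀ x y : 𝔏, 0 ≤ 2 * ‖A‖ * (if x ∈ Z ∧ y ∈ Z then ‖Φ Z‖ else 0) := by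
      intro x y
      split_ifs <;> positivity
    by_cases hd : Disjoint Z Λ
    · rw [hloc Z hd]
      simp only [sub_self, smul_zero, norm_zero]
      exact Finset.sum_nonneg fun y _ => Finset.sum_nonneg fun x _ => hnn x y
    · obtain ⟨y, hyZ, hyΛ⟩ := Finset.not_disjoint_iff.1 hd
      obtain ⟨x, hxX, hxZ⟩ := hT Z hZ
      calc ‖(Complex.I : ℂ) • (Φ Z * A - A * Φ Z)‖ = ‖Φ Z * A - A * Φ Z‖ := by
            rw [norm_smul]; simp
        _ ≤ ‖Φ Z * A‖ + ‖A * Φ Z‖ := norm_sub_le _ _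
        _ ≤ ‖Φ Z‖ * ‖A‖ + ‖A‖ * ‖Φ Z‖ := add_le_add (norm_mul_le _ _) (norm_mul_le _ _)
        _ = 2 * ‖A‖ * (if x ∈ Z ∧ y ∈ Z then ‖Φ Z‖ else 0) := by
            rw [if_pos ⟨hxZ, hyZ⟩]; ring
        _ ≤ ∑ x ∈ X, 2 * ‖A‖ * (if x ∈ Z ∧ y ∈ Z then ‖Φ Z‖ else 0) :=
            Finset.single_le_sum
              (f := fun x => 2 * ‖A‖ * (if x ∈ Z ∧ y ∈ Z then ‖Φ Z‖ else 0))
              (fun x _ => hnn x y) hxX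
        _ ≤ _ := Finset.single_le_sum
              (f := fun y => ∑ x ∈ X, 2 * ‖A‖ * (if x ∈ Z ∧ y ∈ Z then ‖Φ Z‖ else 0))
              (fun y _ => Finset.sum_nonneg fun x _ => hnn x y) hyΛ
  have hxy : ∀ x y : 𝔏, ∑ Z ∈ T, (if x ∈ Z ∧ y ∈ Z then ‖Φ Z‖ else 0) ≤ C * F x y := by
    intro x y
    rw [← Finset.sum_filter, ← Finset.sum_subtype_of_mem (p := fun Z => x ∈ Z ∧ y ∈ Z)
      (fun Z => ‖Φ Z‖) (fun Z hZ => (Finset.mem_filter.1 hZ).2)]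
    exact ((hW x y).1.sum_le_tsum _ (fun _ _ => norm_nonneg _)).trans (hW x y).2
  calc _ ≤ ∑ Z ∈ T, ‖(Complex.I : ℂ) • (Φ Z * A - A * Φ Z)‖ := norm_sum_le _ _
    _ ≤ ∑ Z ∈ T, ∑ y ∈ Λ, ∑ x ∈ X, 2 * ‖A‖ * (if x ∈ Z ∧ y ∈ Z then ‖Φ Z‖ else 0) :=
        Finset.sum_le_sum hpt
    _ = ∑ y ∈ Λ, 2 * ‖A‖ * ∑ x ∈ X, ∑ Z ∈ T, (if x ∈ Z ∧ y ∈ Z then ‖Φ Z‖ else 0) := by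
        rw [Finset.sum_comm]
        refine Finset.sum_congr rfl fun y _ => ?_
        rw [Finset.sum_comm, Finset.mul_sum]
        exact Finset.sum_congr rfl fun x _ => by rw [Finset.mul_sum]
    _ ≤ ∑ y ∈ Λ, 2 * ‖A‖ * (C * M) := by
        refine Finset.sum_le_sum fun y hy => ?_
        refine mul_le_mul_of_nonneg_left ?_ (by positivity)
        refine (Finset.sum_le_sum fun x _ => hxy x y).trans ?_
        rw [← Finset.mul_sum]
        exact mul_le_mul_of_nonneg_left (hM y hy) hC
    _ = _ := by
        rw [Finset.sum_const, nsmul_eq_mul]; ring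

/-- Estimates on the finite-volume derivations applied to a local element `A`. -/
theorem finiteVolumeDeriv_estimates
    {𝔏 𝒰 : Type*} [CStarAlgebra 𝒰]
    (F : 𝔏 → 𝔏 → ℝ) (K : ℝ)
    (hF0 : ∀ x y : 𝔏, 0 < F x y) (hF1 : ∀ x y : 𝔏, F x y ≤ 1)
    (hFsum : ∀ y : 𝔏, Summable fun x : 𝔏 => F x y)
    (hFK : ∀ y : 𝔏, (∑' x : 𝔏, F x y) ≤ K)
    (Φ : Finset 𝔏 → 𝒰) (hΦ : IsInteraction Φ) (C : ℝ) (hW : HasWNormLE Φ F C)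
    (Λ : Finset 𝔏) (A : 𝒰)
    (hloc : ∀ Z : Finset 𝔏, Disjoint Z Λ → Φ Z * A = A * Φ Z) :
    (∀ S₁ S₂ : Finset 𝔏, S₁ ⊆ S₂ →
      ‖finiteVolumeDeriv Φ A S₂ - finiteVolumeDeriv Φ A S₁‖ ≤
        2 * Λ.card * ‖A‖ * C * ⨆ y ∈ Λ, ∑' x : {x : 𝔏 // x ∉ S₁}, F x.1 y) ∧
    (∀ S : Finset 𝔏, ‖finiteVolumeDeriv Φ A S‖ ≤ 2 * Λ.card * ‖A‖ * C * K) := by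
  classical
  have hC : ∀ y ∈ Λ, 0 ≤ C := by
    intro y _
    have h := (tsum_nonneg (fun Z : {Z : Finset 𝔏 // y ∈ Z ∧ y ∈ Z} =>
      norm_nonneg (Φ Z.1))).trans (hW y y).2
    exact nonneg_of_mul_nonneg_left h (hF0 y y)
  have hsub : ∀ (S : Finset 𝔏) (y : 𝔏), ∑' x : {x : 𝔏 // x ∉ S}, F x.1 y ≤ K := fun S y =>
    ((hFsum y).tsum_subtype_le (fun x => F x y) {x | x ∉ S} (fun x => (hF0 x y).le)).trans
      (hFK y)
  have hi : ∀ S₁ S₂ : Finset 𝔏, S₁ ⊆ S₂ → ∀ M : ℝ,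
      (∀ y ∈ Λ, ∑' x : {x : 𝔏 // x ∉ S₁}, F x.1 y ≤ M) →
      ‖finiteVolumeDeriv Φ A S₂ - finiteVolumeDeriv Φ A S₁‖ ≤ 2 * Λ.card * ‖A‖ * C * M := by
    intro S₁ S₂ h12 M hM
    rcases Λ.eq_empty_or_nonempty with rfl | ⟨y₀, hy₀⟩
    · have h0 : ∀ S, finiteVolumeDeriv Φ A S = 0 := fun S =>
        Finset.sum_eq_zero fun Z _ => by
          rw [hloc Z (Finset.disjoint_empty_right Z), sub_self, smul_zero]
      simp [h0]
    · unfold finiteVolumeDeriv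
      rw [← Finset.sum_sdiff (Finset.powerset_mono.2 h12), add_sub_cancel_right]
      refine core_bound F Φ C (hC y₀ hy₀) hW Λ A hloc _ (S₂ \ S₁) ?_ M ?_
      · intro Z hZ
        simp only [Finset.mem_sdiff, Finset.mem_powerset] at hZ
        obtain ⟨x, hx, hx1⟩ := Finset.not_subset.1 hZ.2
        exact ⟨x, Finset.mem_sdiff.2 ⟨hZ.1 hx, hx1⟩, hx⟩
      · intro y hy
        refine le_trans ?_ (hM y hy)
        rw [← Finset.sum_subtype_of_mem (p := fun x => x ∉ S₁)
          (fun x => F x y) (fun x hx => (Finset.mem_sdiff.1 hx).2)]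
        exact ((hFsum y).subtype {x | x ∉ S₁}).sum_le_tsum _ (fun x _ => (hF0 _ _).le)
  refine ⟨fun S₁ S₂ h12 => hi S₁ S₂ h12 _ ?_, fun S => ?_⟩
  · intro y hy
    have hb : BddAbove (Set.range fun y => ⨆ _ : y ∈ Λ, ∑' x : {x : 𝔏 // x ∉ S₁}, F x.1 y) := by
      refine ⟨max K 0, ?_⟩
      rintro _ ⟨z, rfl⟩
      exact Real.iSup_le (fun _ => (hsub S₁ z).trans (le_max_left _ _)) (le_max_right _ _)
    refine le_trans (le_of_eq ?_) (le_ciSup hb y)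
    simp only [hy, ciSup_pos]
  · have h := hi ∅ S (Finset.empty_subset S) K (fun y _ => hsub ∅ y)
    have h0 : finiteVolumeDeriv Φ A ∅ = 0 := by
      simp [finiteVolumeDeriv, hloc ∅ (Finset.disjoint_empty_left Λ)]
    rwa [h0, sub_zero] at h
end

section
/- Let 𝔏 be a set, 𝒰 a unital complex C*-algebra, and F : 𝔏 × 𝔏 → ℝ with 0 < F(x,y) ≤ 1 such that for each y ∈ 𝔏 the family (F(x,y))_{x ∈ 𝔏} is summable with sum ≤ K. Let Φ be an interaction with W-norm at most C relative to F, let Λ ⊆ 𝔏 be finite, and let A ∈ 𝒰 satisfy Φ(Z)·A = A·Φ(Z) for every finite Z ⊆ 𝔏 with Z ∩ Λ = ∅. Then the net of finite-volume derivatives S ↦ Σ_{Z ⊆ S} i·(Φ(Z)A − AΦ(Z)), indexed by the finite subsets S of 𝔏 directed by inclusion, converges in norm to an element δ^Φ(A) ∈ 𝒰, and this limit satisfies ‖δ^Φ(A)‖ ≤ 2·|Λ|·‖A‖·C·K. -/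
/-- The net of finite-volume derivations applied to a local element `A` converges in norm,
and the limit `δ^Φ(A)` satisfies `‖δ^Φ(A)‖ ≤ 2·|Λ|·‖A‖·C·K`. -/
theorem finiteVolumeDeriv_converges
    {𝔏 𝒰 : Type*} [CStarAlgebra 𝒰]
    (F : 𝔏 → 𝔏 → ℝ) (K : ℝ)
    (hF0 : ∀ x y : 𝔏, 0 < F x y) (hF1 : ∀ x y : 𝔏, F x y ≤ 1)
    (hFsum : ∀ y : 𝔏, Summable fun x : 𝔏 => F x y)
    (hFK : ∀ y : 𝔏, (∑' x : 𝔏, F x y) ≤ K)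
    (Φ : Finset 𝔏 → 𝒰) (hΦ : IsInteraction Φ) (C : ℝ) (hW : HasWNormLE Φ F C)
    (Λ : Finset 𝔏) (A : 𝒰)
    (hloc : ∀ Z : Finset 𝔏, Disjoint Z Λ → Φ Z * A = A * Φ Z) :
    ∃ D : 𝒰, Filter.Tendsto (finiteVolumeDeriv Φ A) Filter.atTop (nhds D) ∧
      ‖D‖ ≤ 2 * Λ.card * ‖A‖ * C * K := by
  classical
  set f : Finset 𝔏 → 𝒰 := fun Z => (Complex.I : ℂ) • (Φ Z * A - A * Φ Z) with hf
  set g : 𝔏 → Finset 𝔏 → ℝ :=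
    fun y => Set.indicator {Z : Finset 𝔏 | y ∈ Z ∧ y ∈ Z} (fun Z => ‖Φ Z‖) with hg
  have hgs : ∀ y, Summable (g y) := fun y =>
    summable_subtype_iff_indicator.mp (hW y y).1
  have hgt : ∀ y, ∑' Z, g y Z ≤ C * F y y := by
    intro y
    have h1 := (hW y y).2
    have h2 := tsum_subtype {Z : Finset 𝔏 | y ∈ Z ∧ y ∈ Z} (fun Z => ‖Φ Z‖)
    exact h2.symm.le.trans h1
  have hg0 : ∀ y Z, 0 ≤ g y Z := fun y Z =>
    Set.indicator_nonneg (fun _ _ => norm_nonneg _) Z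
  have hgK : ∀ y, ∑' Z, g y Z ≤ C * K := by
    intro y
    have hC : 0 ≤ C := by
      have h := (tsum_nonneg (hg0 y)).trans (hgt y)
      exact nonneg_of_mul_nonneg_left h (hF0 y y)
    have hFy : F y y ≤ K :=
      ((hFsum y).le_tsum y (fun x _ => (hF0 x y).le)).trans (hFK y)
    exact (hgt y).trans (mul_le_mul_of_nonneg_left hFy hC)
  have hbound : ∀ Z, ‖f Z‖ ≤ 2 * ‖A‖ * ∑ y ∈ Λ, g y Z := by
    intro Z
    have hs0 : 0 ≤ ∑ y ∈ Λ, g y Z := Finset.sum_nonneg (fun y _ => hg0 y Z)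
    by_cases hd : Disjoint Z Λ
    · have : f Z = 0 := by simp [hf, hloc Z hd]
      rw [this, norm_zero]
      positivity
    · obtain ⟨y, hyZ, hyΛ⟩ := Finset.not_disjoint_iff.mp hd
      have h1 : ‖Φ Z‖ ≤ ∑ y ∈ Λ, g y Z := by
        have h2 : g y Z = ‖Φ Z‖ := by simp [hg, hyZ]
        rw [← h2]
        exact Finset.single_le_sum (f := fun y => g y Z) (fun y _ => hg0 y Z) hyΛ
      have h3 : ‖f Z‖ ≤ 2 * ‖A‖ * ‖Φ Z‖ := by
        calc ‖f Z‖ = ‖Φ Z * A - A * Φ Z‖ := by simp [hf, norm_smul]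
          _ ≤ ‖Φ Z * A‖ + ‖A * Φ Z‖ := norm_sub_le _ _
          _ ≤ ‖Φ Z‖ * ‖A‖ + ‖A‖ * ‖Φ Z‖ := add_le_add (norm_mul_le _ _) (norm_mul_le _ _)
          _ = 2 * ‖A‖ * ‖Φ Z‖ := by ring
      exact h3.trans (mul_le_mul_of_nonneg_left h1 (by positivity))
  have hsum : HasSum (fun Z => 2 * ‖A‖ * ∑ y ∈ Λ, g y Z)
      (2 * ‖A‖ * ∑ y ∈ Λ, ∑' Z, g y Z) :=
    (hasSum_sum (fun y _ => (hgs y).hasSum)).mul_left _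
  have hfs : Summable f := Summable.of_norm_bounded hsum.summable hbound
  refine ⟨∑' Z, f Z, ?_, ?_⟩
  · have h5 : Filter.Tendsto (fun s : Finset (Finset 𝔏) => ∑ Z ∈ s, f Z) Filter.atTop
        (nhds (∑' Z, f Z)) := hfs.hasSum
    exact h5.comp Filter.tendsto_finset_powerset_atTop_atTop
  · refine (tsum_of_norm_bounded hsum hbound).trans ?_
    have h4 : ∑ y ∈ Λ, ∑' Z, g y Z ≤ Λ.card * (C * K) := by
      have := Finset.sum_le_card_nsmul Λ (fun y => ∑' Z, g y Z) (C * K) (fun y _ => hgK y)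
      simpa using this
    calc 2 * ‖A‖ * ∑ y ∈ Λ, ∑' Z, g y Z ≤ 2 * ‖A‖ * (Λ.card * (C * K)) :=
          mul_le_mul_of_nonneg_left h4 (by positivity)
      _ = 2 * Λ.card * ‖A‖ * C * K := by ring
end

section
/- Let 𝔏 be a set, 𝒰 a unital complex C*-algebra, and F : 𝔏 × 𝔏 → ℝ with 0 < F(x,y) ≤ 1 and F(x,x) = 1 for all x, such that for each y the family (F(x,y))_{x ∈ 𝔏} is summable with sum ≤ K (so K ≥ 1). If Φ is an interaction with W-norm at most C relative to F, then for every finite set S ⊆ 𝔏 the local energy element U_S^Φ := Σ_{Z ⊆ S} Φ(Z) satisfies ‖U_S^Φ‖ ≤ |S|·K·C. -/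
/-- The local energy element `U_S^Φ = ∑_{Z ⊆ S} Φ(Z)` satisfies `‖U_S^Φ‖ ≤ |S|·K·C`. -/
theorem norm_localEnergy_le
    {𝔏 𝒰 : Type*} [CStarAlgebra 𝒰]
    (F : 𝔏 → 𝔏 → ℝ) (K : ℝ)
    (hF0 : ∀ x y : 𝔏, 0 < F x y) (hF1 : ∀ x y : 𝔏, F x y ≤ 1)
    (hFdiag : ∀ x : 𝔏, F x x = 1)
    (hFsum : ∀ y : 𝔏, Summable fun x : 𝔏 => F x y)
    (hFK : ∀ y : 𝔏, (∑' x : 𝔏, F x y) ≤ K)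
    (Φ : Finset 𝔏 → 𝒰) (hΦ : IsInteraction Φ) (C : ℝ) (hW : HasWNormLE Φ F C)
    (S : Finset 𝔏) :
    ‖∑ Z ∈ S.powerset, Φ Z‖ ≤ S.card * K * C := by
  classical
  have key : ∀ x : 𝔏, ∑ Z ∈ S.powerset with x ∈ Z, ‖Φ Z‖ ≤ C := by
    intro x
    obtain ⟨hs, hle⟩ := hW x x
    rw [hFdiag, mul_one] at hle
    refine le_trans ?_ hle
    have h := hs.sum_le_tsum
      ((S.powerset.filter (fun Z => x ∈ Z)).subtype (fun Z => x ∈ Z ∧ x ∈ Z))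
      (fun _ _ => norm_nonneg _)
    refine le_trans (le_of_eq ?_) h
    rw [Finset.sum_subtype_eq_sum_filter (f := fun Z : Finset 𝔏 => ‖Φ Z‖)]
    rw [Finset.filter_filter]
    simp
  have h1 : ‖∑ Z ∈ S.powerset, Φ Z‖ ≤ ∑ x ∈ S, ∑ Z ∈ S.powerset with x ∈ Z, ‖Φ Z‖ := by
    refine (norm_sum_le _ _).trans ?_
    simp_rw [Finset.sum_filter]
    rw [Finset.sum_comm]
    refine Finset.sum_le_sum fun Z hZ => ?_
    rcases Z.eq_empty_or_nonempty with rfl | ⟨x, hx⟩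
    · have h0 : Φ ∅ = 0 := hΦ
      simp [h0]
    · have hxS : x ∈ S := Finset.mem_powerset.1 hZ hx
      have := Finset.single_le_sum (f := fun y => if y ∈ Z then ‖Φ Z‖ else 0)
        (fun y _ => by split_ifs <;> simp) hxS
      simpa [hx] using this
  have h2 : ∀ x ∈ S, ∑ Z ∈ S.powerset with x ∈ Z, ‖Φ Z‖ ≤ K * C := by
    intro x _
    have hC : 0 ≤ C := (Finset.sum_nonneg fun _ _ => norm_nonneg _).trans (key x)
    have hK : 1 ≤ K := by
      have := (hFsum x).le_tsum x (fun y _ => (hF0 y x).le)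
      rw [hFdiag] at this
      exact this.trans (hFK x)
    exact (key x).trans (le_mul_of_one_le_left hC hK)
  have h3 := Finset.sum_le_card_nsmul S _ _ h2
  rw [nsmul_eq_mul, ← mul_assoc] at h3
  exact h1.trans h3
end
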